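/- Let U > 0, let N and M be positive integers, let k_1,…,k_N ∈ ℝ and μ_1,…,μ_M ∈ ℝ, let J be a real number, and suppose Λ, Λ' ∈ ℝ with Λ ≤ Λ' satisfy Σ_{j=1}^N θ_U(2·sin k_j − 2Λ) + Σ_{β=1}^M θ_U(Λ − μ_β) = 2π·J and Σ_{j=1}^N θ_U(2·sin k_j − 2Λ') + Σ_{β=1}^M θ_U(Λ' − μ_β) = 2π·(J+1). Then Λ' − Λ ≥ π·U/(4N). -/

import Mathlib

open Real

/-- The phase function `θ_U(x) = -2 arctan(2x/U)` of the Lieb–Wu equations. -/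
noncomputable def theta (U x : ℝ) : ℝ := -2 * Real.arctan (2 * x / U)

theorem arctan_sub_arctan_le {a b : ℝ} (h : a ≤ b) : arctan b - arctan a ≤ b - a := by
  have hanti : Antitone fun x : ℝ => arctan x - x := by
    have hderiv (x : ℝ) : HasDerivAt (fun x : ℝ => arctan x - x) (1 / (1 + x ^ 2) - 1) x :=
      (hasDerivAt_arctan x).sub (hasDerivAt_id x)
    refine antitone_of_deriv_nonpos (fun x => (hderiv x).differentiableAt) fun x => ?_
    rw [(hderiv x).deriv, sub_nonpos, div_le_one (by positivity)]
    linarith [sq_nonneg x]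
  have := hanti h
  dsimp only at this
  linarith

theorem theta_antitone {U : ℝ} (hU : 0 < U) : Antitone (theta U) := by
  intro x y hxy
  have : arctan (2 * x / U) ≤ arctan (2 * y / U) := arctan_mono (by gcongr)
  unfold theta
  linarith

theorem theta_sub_theta_le {U : ℝ} (hU : 0 < U) {x y : ℝ} (hxy : x ≤ y) :
    theta U x - theta U y ≤ 4 * (y - x) / U := by
  have h : 2 * x / U ≤ 2 * y / U := by gcongr
  calc theta U x - theta U y = 2 * (arctan (2 * y / U) - arctan (2 * x / U)) := by
        unfold theta; ring
    _ ≤ 2 * (2 * y / U - 2 * x / U) :=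
        mul_le_mul_of_nonneg_left (arctan_sub_arctan_le h) zero_le_two
    _ = 4 * (y - x) / U := by ring

/-- Two consecutive spin rapidities (with quantum numbers `J` and `J+1`) are separated
by at least `πU/(4N)`. -/
theorem consecutive_lambda_separation
    (U : ℝ) (hU : 0 < U) (N M : ℕ) (hN : 0 < N) (hM : 0 < M)
    (k : Fin N → ℝ) (μ : Fin M → ℝ) (J : ℝ) (Λ Λ' : ℝ) (hΛ : Λ ≤ Λ')
    (h₁ : ∑ j : Fin N, theta U (2 * Real.sin (k j) - 2 * Λ)
        + ∑ β : Fin M, theta U (Λ - μ β) = 2 * π * J)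
    (h₂ : ∑ j : Fin N, theta U (2 * Real.sin (k j) - 2 * Λ')
        + ∑ β : Fin M, theta U (Λ' - μ β) = 2 * π * (J + 1)) :
    π * U / (4 * (N : ℝ)) ≤ Λ' - Λ := by
  have hcharge : ∑ j, theta U (2 * Real.sin (k j) - 2 * Λ')
      - ∑ j, theta U (2 * Real.sin (k j) - 2 * Λ) ≤ N * (8 * (Λ' - Λ) / U) := by
    rw [← Finset.sum_sub_distrib]
    refine (Finset.sum_le_card_nsmul _ _ (8 * (Λ' - Λ) / U) fun j _ => ?_).trans_eq (by simp)
    refine (theta_sub_theta_le hU (by linarith)).trans_eq ?_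
    ring
  have hspin : ∑ β, theta U (Λ' - μ β) ≤ ∑ β, theta U (Λ - μ β) :=
    Finset.sum_le_sum fun β _ => theta_antitone hU (by linarith)
  have hN' : (0 : ℝ) < N := by exact_mod_cast hN
  have hmain : 2 * π ≤ N * (8 * (Λ' - Λ) / U) := by linarith
  rw [← mul_div_assoc, le_div_iff₀ hU] at hmain
  rw [div_le_iff₀ (by positivity)]
  linarith
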